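/- Fix game G_i and suppose the Eater plays π^{E*}. If π^M is any admissible Mover strategy whose resulting path from p(0) to g_i has length strictly greater than d(p(0), g_i), then J_i(π^M, π^{E*}) ≥ J_i(π^{M*}_i, π^{E*}); i.e., the Mover has no incentive to use a non-shortest path against π^{E*}. -/

import Mathlib

noncomputable section

open Classical

/-- Manhattan distance on the grid ℤ². -/
def mdist (p q : ℤ × ℤ) : ℤ := |p.1 - q.1| + |p.2 - q.2|

/-- The four admissible unit moves of the Mover. -/
def IsUnitMove (e : ℤ × ℤ) : Prop :=
  e = (1, 0) ∨ e = (-1, 0) ∨ e = (0, 1) ∨ e = (0, -1)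

/-- The Eater action that eats one banana from goal `j`. -/
def eatOne (j : Fin 2) : Fin 2 → ℝ := fun k => if k = j then 1 else 0

/-- The Eater action that eats half a banana from each goal. -/
def eatHalf : Fin 2 → ℝ := fun _ => 1 / 2

/-- The three admissible Eater actions. -/
def IsEaterAction (a : Fin 2 → ℝ) : Prop :=
  a = eatOne 0 ∨ a = eatOne 1 ∨ a = eatHalf

/-- A Mover strategy: maps (position, consumption vector) to a move. -/
abbrev MoverStrategy : Type := ℤ × ℤ → (Fin 2 → ℝ) → ℤ × ℤ

/-- An Eater strategy: maps (new Mover position, last Mover move, current consumption)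
to an Eater action; it is the same in both games. -/
abbrev EaterStrategy : Type := ℤ × ℤ → ℤ × ℤ → (Fin 2 → ℝ) → Fin 2 → ℝ

def ValidMover (piM : MoverStrategy) : Prop := ∀ p b, IsUnitMove (piM p b)

def ValidEater (piE : EaterStrategy) : Prop := ∀ p a b, IsEaterAction (piE p a b)

/-- State trajectory (position, consumption vector) of the game under a strategy pair:
`p(t+1) = p(t) + a^M(t)`, `b(t+1) = b(t) + a^E(t)`. -/
def traj (piM : MoverStrategy) (piE : EaterStrategy) (p0 : ℤ × ℤ) (b0 : Fin 2 → ℝ) :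
    ℕ → (ℤ × ℤ) × (Fin 2 → ℝ)
  | 0 => (p0, b0)
  | t + 1 =>
    let s := traj piM piE p0 b0 t
    let m := piM s.1 s.2
    (s.1 + m, fun j => s.2 j + piE (s.1 + m) m s.2 j)

/-- Termination time of game `G_i`: the first time the Mover's position equals `goal`. -/
def hitTime (piM : MoverStrategy) (piE : EaterStrategy) (p0 : ℤ × ℤ) (b0 : Fin 2 → ℝ)
    (goal : ℤ × ℤ) : ℕ :=
  sInf {t | (traj piM piE p0 b0 t).1 = goal}

/-- The outcome `J_i` of game `G_i`: consumption at the true goal `g i` at termination. -/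
def outcome (g : Fin 2 → ℤ × ℤ) (i : Fin 2) (piM : MoverStrategy) (piE : EaterStrategy)
    (p0 : ℤ × ℤ) (b0 : Fin 2 → ℝ) : ℝ :=
  (traj piM piE p0 b0 (hitTime piM piE p0 b0 (g i))).2 i

/-- Admissibility: the Mover reaches the goal in finite time. -/
def Reaches (piM : MoverStrategy) (piE : EaterStrategy) (p0 : ℤ × ℤ) (b0 : Fin 2 → ℝ)
    (goal : ℤ × ℤ) : Prop :=
  ∃ t, (traj piM piE p0 b0 t).1 = goal

/-- A step from `p` to `p'` is ambiguous: `δd₁ = δd₂`. -/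
def IsAmbStep (g : Fin 2 → ℤ × ℤ) (p p' : ℤ × ℤ) : Prop :=
  mdist p' (g 0) - mdist p (g 0) = mdist p' (g 1) - mdist p (g 1)

/-- A step from `p` to `p'` is explicit: `δd₁ = −δd₂`. -/
def IsExpStep (g : Fin 2 → ℤ × ℤ) (p p' : ℤ × ℤ) : Prop :=
  mdist p' (g 0) - mdist p (g 0) = -(mdist p' (g 1) - mdist p (g 1))

/-- A path of `T` unit moves from `p` to `goal`. -/
def IsPath (p goal : ℤ × ℤ) (T : ℕ) (q : ℕ → ℤ × ℤ) : Prop :=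
  q 0 = p ∧ q T = goal ∧ ∀ t < T, IsUnitMove (q (t + 1) - q t)

/-- Number of ambiguous moves along a path. -/
def ambCount (g : Fin 2 → ℤ × ℤ) (T : ℕ) (q : ℕ → ℤ × ℤ) : ℕ :=
  ((Finset.range T).filter fun t => IsAmbStep g (q t) (q (t + 1))).card

/-- Number of explicit moves along a path. -/
def expCount (g : Fin 2 → ℤ × ℤ) (T : ℕ) (q : ℕ → ℤ × ℤ) : ℕ :=
  ((Finset.range T).filter fun t => IsExpStep g (q t) (q (t + 1))).card

/-- `n^a(p)`: minimum number of ambiguous moves over paths from `p` to a goal. -/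
def naN (g : Fin 2 → ℤ × ℤ) (p : ℤ × ℤ) : ℕ :=
  sInf {n : ℕ | ∃ i : Fin 2, ∃ T q, IsPath p (g i) T q ∧ ambCount g T q = n}

/-- `n^r_i(p)`: minimum number of explicit moves needed to reach `g i` from `p`. -/
def nrN (g : Fin 2 → ℤ × ℤ) (i : Fin 2) (p : ℤ × ℤ) : ℕ :=
  sInf {n : ℕ | ∃ T q, IsPath p (g i) T q ∧ expCount g T q = n}

/-- The equilibrium Eater strategy `π^{E*}`: after an ambiguous Mover move the
conservative action (based on the sign of `δ̃c₁`), after an explicit move the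
exploiting action (eat from the approached goal). -/
def piEstar (g : Fin 2 → ℤ × ℤ) : EaterStrategy := fun p' a b =>
  let p := p' - a
  let d1 := mdist p' (g 0) - mdist p (g 0)
  let d2 := mdist p' (g 1) - mdist p (g 1)
  if d1 = d2 then
    if (b 0 + (mdist p' (g 0) : ℝ)) - (b 1 + (mdist p' (g 1) : ℝ)) < 0 then eatOne 0
    else if 0 < (b 0 + (mdist p' (g 0) : ℝ)) - (b 1 + (mdist p' (g 1) : ℝ)) then eatOne 1
    else eatHalf
  else if d1 < d2 then eatOne 0
  else eatOne 1

/-- `π^{M*}_i`: the Mover strategy that (against any Eater strategy) follows a shortest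
path from `p0` to `g i`, performing all `n^a(p0)` ambiguous moves first and then the
explicit moves. -/
def IsMoverStar (g : Fin 2 → ℤ × ℤ) (i : Fin 2) (p0 : ℤ × ℤ) (b0 : Fin 2 → ℝ)
    (piM : MoverStrategy) : Prop :=
  ValidMover piM ∧
  ∀ piE : EaterStrategy, ValidEater piE →
    (traj piM piE p0 b0 (mdist p0 (g i)).toNat).1 = g i ∧
    ∀ t < (mdist p0 (g i)).toNat,
      (IsAmbStep g (traj piM piE p0 b0 t).1 (traj piM piE p0 b0 (t + 1)).1 ↔ t < naN g p0)

/-- `c_i(p, b) = b_i + d(p, g_i)`. -/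
def cval (g : Fin 2 → ℤ × ℤ) (i : Fin 2) (p : ℤ × ℤ) (b : Fin 2 → ℝ) : ℝ :=
  b i + (mdist p (g i) : ℝ)

/-- `δc_i = c_i − c_{3−i}`. -/
def dcval (g : Fin 2 → ℤ × ℤ) (i : Fin 2) (p : ℤ × ℤ) (b : Fin 2 → ℝ) : ℝ :=
  cval g i p b - cval g (1 - i) p b

end

noncomputable section
open Classical

def gainF (x : ℝ) : ℝ := if x < 0 then 0 else if 0 < x then 1 else 1 / 2

def fF : ℕ → ℝ → ℝ
  | 0, _ => 0
  | n + 1, x => gainF x + fF n (x + 1 - 2 * gainF x)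

theorem fin2_cases (i j : Fin 2) (hij : i ≠ j) : (i = 0 ∧ j = 1) ∨ (i = 1 ∧ j = 0) := by
  omega

theorem gainF_neg {x : ℝ} (h : x < 0) : gainF x = 0 := by simp [gainF, h]
theorem gainF_pos {x : ℝ} (h : 0 < x) : gainF x = 1 := by
  simp [gainF, h, not_lt.mpr h.le]
theorem gainF_zero : gainF 0 = 1 / 2 := by simp [gainF]
theorem gainF_le (x : ℝ) : gainF x ≤ 1 := by
  unfold gainF; split_ifs <;> norm_num

theorem fF_succ_le (n : ℕ) : ∀ x, fF (n + 1) x ≤ fF n x + 1 := by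
  induction n with
  | zero => intro x; simp [fF, gainF_le]
  | succ n ih =>
    intro x
    have := ih (x + 1 - 2 * gainF x)
    rw [fF, fF.eq_2 x n]; linarith

theorem fF_shift (n : ℕ) : ∀ x, fF n (x - 1) ≤ fF n x ∧ fF n x ≤ fF n (x - 1) + 1 := by
  induction n with
  | zero => intro x; simp [fF]
  | succ n ih =>
    intro x
    simp only [fF]
    rcases lt_trichotomy x 0 with h | h | h
    · rw [gainF_neg h, gainF_neg (by linarith : x - 1 < 0)]
      have := ih (x + 1)
      ring_nf at this ⊢
      constructor <;> linarith [this.1, this.2]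
    · subst h
      rw [gainF_zero, gainF_neg (by norm_num : (0:ℝ) - 1 < 0)]
      norm_num
      linarith
    · rw [gainF_pos h]
      rcases lt_trichotomy x 1 with h1 | h1 | h1
      · rw [gainF_neg (by linarith : x - 1 < 0)]
        have := ih x
        ring_nf at this ⊢
        constructor <;> linarith [this.1, this.2]
      · subst h1
        rw [sub_self, gainF_zero]
        norm_num
        linarith
      · rw [gainF_pos (by linarith : 0 < x - 1)]
        have := ih (x - 1)
        ring_nf at this ⊢
        constructor <;> linarith [this.1, this.2]

theorem mdist_move (p m q : ℤ × ℤ) (hm : IsUnitMove m) :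
    mdist (p + m) q = mdist p q + 1 ∨ mdist (p + m) q = mdist p q - 1 := by
  unfold mdist
  rcases hm with h | h | h | h <;> subst h <;> simp <;> grind

def exS (g : Fin 2 → ℤ × ℤ) (p : ℤ × ℤ) : ℤ :=
  mdist p (g 0) + mdist p (g 1) - mdist (g 0) (g 1)

theorem exS_nonneg (g : Fin 2 → ℤ × ℤ) (p : ℤ × ℤ) : 0 ≤ exS g p := by
  unfold exS mdist; grind

theorem mdist_nonneg' (p q : ℤ × ℤ) : 0 ≤ mdist p q := by unfold mdist; positivity

theorem mdist_eq_zero' (p q : ℤ × ℤ) : mdist p q = 0 ↔ p = q := by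
  unfold mdist; rw [Prod.ext_iff]; grind

theorem exS_goal (g : Fin 2 → ℤ × ℤ) (i : Fin 2) : exS g (g i) = 0 := by
  unfold exS mdist
  fin_cases i <;> simp <;> grind

theorem step_cases (g : Fin 2 → ℤ × ℤ) (i j : Fin 2) (hij : i ≠ j) (p m : ℤ × ℤ)
    (b : Fin 2 → ℝ) (hm : IsUnitMove m) (x : ℝ)
    (hx : x = (b i + mdist p (g i)) - (b j + mdist p (g j))) :
    (∃ s : ℤ, (s = 1 ∨ s = -1) ∧ mdist (p + m) (g i) = mdist p (g i) + s ∧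
      mdist (p + m) (g j) = mdist p (g j) + s ∧
      piEstar g (p + m) m b i = 1 - gainF x ∧ piEstar g (p + m) m b j = gainF x) ∨
    (mdist (p + m) (g i) = mdist p (g i) - 1 ∧ mdist (p + m) (g j) = mdist p (g j) + 1 ∧
      piEstar g (p + m) m b i = 1 ∧ piEstar g (p + m) m b j = 0) ∨
    (mdist (p + m) (g i) = mdist p (g i) + 1 ∧ mdist (p + m) (g j) = mdist p (g j) - 1 ∧
      piEstar g (p + m) m b i = 0 ∧ piEstar g (p + m) m b j = 1) := by
  have h0 := mdist_move p m (g 0) hm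
  have h1 := mdist_move p m (g 1) hm
  have hc : (i = 0 ∧ j = 1) ∨ (i = 1 ∧ j = 0) := fin2_cases i j hij
  have key : ∀ s : ℤ, (s = 1 ∨ s = -1) → mdist (p + m) (g 0) = mdist p (g 0) + s →
      mdist (p + m) (g 1) = mdist p (g 1) + s →
      piEstar g (p + m) m b i = 1 - gainF x ∧ piEstar g (p + m) m b j = gainF x := by
    intro s hs e0 e1
    have hp : p + m - m = p := by simp
    simp only [piEstar, hp, e0, e1, add_sub_cancel_left, if_true]
    push_cast
    rcases hc with ⟨rfl, rfl⟩ | ⟨rfl, rfl⟩ <;> rcases lt_trichotomy x 0 with h | h | h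
    · rw [gainF_neg h, if_pos (by linarith)]; simp [eatOne]
    · rw [h, gainF_zero, if_neg (by linarith), if_neg (by linarith)]; norm_num [eatHalf]
    · rw [gainF_pos h, if_neg (by linarith), if_pos (by linarith)]; simp [eatOne]
    · rw [gainF_neg h, if_neg (by linarith), if_pos (by linarith)]; simp [eatOne]
    · rw [h, gainF_zero, if_neg (by linarith), if_neg (by linarith)]; norm_num [eatHalf]
    · rw [gainF_pos h, if_pos (by linarith)]; simp [eatOne]
  have hp : p + m - m = p := by simp
  rcases h0 with e0 | e0 <;> rcases h1 with e1 | e1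
  · left; refine ⟨1, Or.inl rfl, ?_, ?_, key 1 (Or.inl rfl) e0 e1⟩ <;>
      rcases hc with ⟨rfl, rfl⟩ | ⟨rfl, rfl⟩ <;> assumption
  · right
    have : piEstar g (p + m) m b = eatOne 1 := by
      simp only [piEstar, hp, e0, e1]
      rw [if_neg (by omega), if_neg (by omega)]
    rw [this]
    rcases hc with ⟨rfl, rfl⟩ | ⟨rfl, rfl⟩ <;> simp [eatOne, e0, e1]
  · right
    have : piEstar g (p + m) m b = eatOne 0 := by
      simp only [piEstar, hp, e0, e1]
      rw [if_neg (by omega), if_pos (by omega)]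
    rw [this]
    rcases hc with ⟨rfl, rfl⟩ | ⟨rfl, rfl⟩ <;> simp [eatOne, e0, e1]
  · left; refine ⟨-1, Or.inr rfl, ?_, ?_, key (-1) (Or.inr rfl) e0 e1⟩ <;>
      rcases hc with ⟨rfl, rfl⟩ | ⟨rfl, rfl⟩ <;> assumption

theorem exS_eq (g : Fin 2 → ℤ × ℤ) (i j : Fin 2) (hij : i ≠ j) (p : ℤ × ℤ) :
    exS g p = mdist p (g i) + mdist p (g j) - mdist (g 0) (g 1) := by
  have hc : (i = 0 ∧ j = 1) ∨ (i = 1 ∧ j = 0) := fin2_cases i j hij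
  unfold exS
  rcases hc with ⟨rfl, rfl⟩ | ⟨rfl, rfl⟩
  · rfl
  · ring

def PhiF (g : Fin 2 → ℤ × ℤ) (i j : Fin 2) (s : (ℤ × ℤ) × (Fin 2 → ℝ)) : ℝ :=
  s.2 i + mdist s.1 (g i) - fF ((exS g s.1).toNat / 2)
    ((s.2 i + mdist s.1 (g i)) - (s.2 j + mdist s.1 (g j)))

theorem isAmb_iff (g : Fin 2 → ℤ × ℤ) (i j : Fin 2) (hij : i ≠ j) (p p' : ℤ × ℤ) :
    IsAmbStep g p p' ↔
      mdist p' (g i) - mdist p (g i) = mdist p' (g j) - mdist p (g j) := by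
  have hc : (i = 0 ∧ j = 1) ∨ (i = 1 ∧ j = 0) := fin2_cases i j hij
  unfold IsAmbStep
  rcases hc with ⟨rfl, rfl⟩ | ⟨rfl, rfl⟩
  · rfl
  · exact eq_comm

theorem Phi_step (g : Fin 2 → ℤ × ℤ) (i j : Fin 2) (hij : i ≠ j) (p m : ℤ × ℤ)
    (b : Fin 2 → ℝ) (hm : IsUnitMove m) :
    PhiF g i j (p, b) ≤ PhiF g i j (p + m, fun k => b k + piEstar g (p + m) m b k) ∧
    (mdist (p + m) (g i) = mdist p (g i) - 1 → (IsAmbStep g p (p + m) ∨ exS g p = 0) →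
      PhiF g i j (p + m, fun k => b k + piEstar g (p + m) m b k) = PhiF g i j (p, b)) := by
  set x : ℝ := (b i + mdist p (g i)) - (b j + mdist p (g j)) with hx
  have hS := exS_eq g i j hij p
  have hS' := exS_eq g i j hij (p + m)
  have n1 := exS_nonneg g p
  have n2 := exS_nonneg g (p + m)
  rw [isAmb_iff g i j hij]
  simp only [PhiF]
  rw [← hx]
  rcases step_cases g i j hij p m b hm x hx with
    ⟨s, rfl | rfl, e1, e2, a1, a2⟩ | ⟨e1, e2, a1, a2⟩ | ⟨e1, e2, a1, a2⟩
  · have hn : (exS g (p + m)).toNat / 2 = (exS g p).toNat / 2 + 1 := by omega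
    refine ⟨?_, fun h => by omega⟩
    rw [hn, a1, a2, e1, e2]
    push_cast
    have hxx : (b i + (1 - gainF x) + (mdist p (g i) + 1 : ℝ)) -
      (b j + gainF x + (mdist p (g j) + 1 : ℝ)) = x + 1 - 2 * gainF x := by rw [hx]; ring
    rw [hxx]
    have k1 := fF_succ_le ((exS g p).toNat / 2 + 1) x
    have k2 := fF_succ_le ((exS g p).toNat / 2) x
    rw [fF.eq_2 x ((exS g p).toNat / 2 + 1)] at k1
    linarith
  · have hn : (exS g p).toNat / 2 = (exS g (p + m)).toNat / 2 + 1 := by omega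
    suffices h : b i + piEstar g (p + m) m b i + (mdist (p + m) (g i) : ℝ) -
        fF ((exS g (p + m)).toNat / 2) (b i + piEstar g (p + m) m b i + (mdist (p + m) (g i) : ℝ) -
          (b j + piEstar g (p + m) m b j + (mdist (p + m) (g j) : ℝ))) =
        b i + (mdist p (g i) : ℝ) - fF ((exS g p).toNat / 2) x from ⟨h.ge, fun _ _ => h⟩
    rw [hn, a1, a2, e1, e2]
    push_cast
    have hxx : (b i + (1 - gainF x) + (mdist p (g i) + -1 : ℝ)) -
      (b j + gainF x + (mdist p (g j) + -1 : ℝ)) = x + 1 - 2 * gainF x := by rw [hx]; ring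
    rw [hxx, fF]
    ring
  · have hn : exS g (p + m) = exS g p := by omega
    rw [hn, a1, a2, e1, e2]
    push_cast
    have hxx : (b i + 1 + (mdist p (g i) - 1 : ℝ)) -
      (b j + 0 + (mdist p (g j) + 1 : ℝ)) = x - 1 := by rw [hx]; ring
    rw [hxx]
    have k := (fF_shift ((exS g p).toNat / 2) x).1
    refine ⟨by linarith, ?_⟩
    rintro - (h | h)
    · omega
    · simp [h, fF]
  · have hn : exS g (p + m) = exS g p := by omega
    refine ⟨?_, fun h => by omega⟩
    rw [hn, a1, a2, e1, e2]
    push_cast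
    have hxx : (b i + 0 + (mdist p (g i) + 1 : ℝ)) -
      (b j + 1 + (mdist p (g j) - 1 : ℝ)) = x + 1 := by rw [hx]; ring
    rw [hxx]
    have k := (fF_shift ((exS g p).toNat / 2) (x + 1)).2
    rw [add_sub_cancel_right] at k
    linarith

theorem Phi_goal (g : Fin 2 → ℤ × ℤ) (i j : Fin 2) (s : (ℤ × ℤ) × (Fin 2 → ℝ))
    (h : s.1 = g i) : PhiF g i j s = s.2 i := by
  have : mdist (g i) (g i) = 0 := (mdist_eq_zero' _ _).2 rfl
  simp [PhiF, h, exS_goal, fF, this]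

theorem Phi_mono (g : Fin 2 → ℤ × ℤ) (i j : Fin 2) (hij : i ≠ j) (p0 : ℤ × ℤ)
    (b0 : Fin 2 → ℝ) (piM : MoverStrategy) (hM : ValidMover piM) (t : ℕ) :
    PhiF g i j (p0, b0) ≤ PhiF g i j (traj piM (piEstar g) p0 b0 t) := by
  induction t with
  | zero => exact le_rfl
  | succ t ih => exact ih.trans (Phi_step g i j hij _ _ _ (hM _ _)).1

theorem validE (g : Fin 2 → ℤ × ℤ) : ValidEater (piEstar g) := by
  intro p a b
  simp only [piEstar, IsEaterAction]
  split_ifs <;> simp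

theorem dist_lower (q : ℤ × ℤ) (piM : MoverStrategy) (piE : EaterStrategy) (p0 : ℤ × ℤ)
    (b0 : Fin 2 → ℝ) (hM : ValidMover piM) (t k : ℕ) :
    mdist (traj piM piE p0 b0 t).1 q ≤ mdist (traj piM piE p0 b0 (t + k)).1 q + k := by
  induction k with
  | zero => simp
  | succ k ih =>
    have := mdist_move (traj piM piE p0 b0 (t + k)).1 _ q
      (hM (traj piM piE p0 b0 (t + k)).1 (traj piM piE p0 b0 (t + k)).2)
    rw [← add_assoc, traj]
    simp only
    push_cast
    omega

theorem star_outcome (g : Fin 2 → ℤ × ℤ) (i j : Fin 2) (hij : i ≠ j) (p0 : ℤ × ℤ)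
    (b0 : Fin 2 → ℝ) (piM : MoverStrategy) (h : IsMoverStar g i p0 b0 piM) :
    outcome g i piM (piEstar g) p0 b0 = PhiF g i j (p0, b0) := by
  obtain ⟨hM, h⟩ := h
  obtain ⟨hD, hamb⟩ := h _ (validE g)
  set D := (mdist p0 (g i)).toNat with hDdef
  set τ := traj piM (piEstar g) p0 b0 with hτ
  have hD0 : (D : ℤ) = mdist p0 (g i) := Int.toNat_of_nonneg (mdist_nonneg' _ _)
  have hz : mdist (g i) (g i) = 0 := (mdist_eq_zero' _ _).2 rfl
  have hdist : ∀ t, t ≤ D → mdist (τ t).1 (g i) = D - t := by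
    intro t ht
    have a := dist_lower (g i) piM (piEstar g) p0 b0 hM 0 t
    have c := dist_lower (g i) piM (piEstar g) p0 b0 hM t (D - t)
    rw [Nat.add_sub_cancel' ht, ← hτ, hD, hz] at c
    rw [Nat.zero_add, ← hτ] at a
    have : (τ 0).1 = p0 := rfl
    rw [this] at a
    omega
  have hhit : hitTime piM (piEstar g) p0 b0 (g i) = D := by
    apply le_antisymm
    · exact Nat.sInf_le hD
    · refine le_csInf ⟨D, hD⟩ ?_
      intro t ht
      by_contra hlt
      have a := hdist t (by omega)
      have ht' : (τ t).1 = g i := ht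
      rw [ht', hz] at a
      omega
  have hex : ∀ k t, t + k = D → naN g p0 ≤ t → exS g (τ t).1 = 0 := by
    intro k
    induction k with
    | zero => intro t ht _; rw [show t = D by omega, hD, exS_goal]
    | succ k ih =>
      intro t ht hn
      have a := ih (t + 1) (by omega) (by omega)
      have na : ¬ IsAmbStep g (τ t).1 (τ (t + 1)).1 := by
        rw [hamb t (by omega)]; omega
      rw [isAmb_iff g i j hij] at na
      rw [exS_eq g i j hij] at a ⊢
      have e1 := mdist_move (τ t).1 _ (g i) (hM (τ t).1 (τ t).2)
      have e2 := mdist_move (τ t).1 _ (g j) (hM (τ t).1 (τ t).2)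
      have e : (τ (t + 1)).1 = (τ t).1 + piM (τ t).1 (τ t).2 := rfl
      rw [← e] at e1 e2
      omega
  have hPhi : ∀ t, t ≤ D → PhiF g i j (τ t) = PhiF g i j (p0, b0) := by
    intro t
    induction t with
    | zero => intro _; rfl
    | succ t ih =>
      intro ht
      rw [← ih (by omega)]
      refine (Phi_step g i j hij (τ t).1 _ (τ t).2 (hM _ _)).2 ?_ ?_
      · have a := hdist t (by omega)
        have c := hdist (t + 1) ht
        have e : (τ (t + 1)).1 = (τ t).1 + piM (τ t).1 (τ t).2 := rfl
        rw [← e]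
        push_cast at c
        omega
      · by_cases hn : t < naN g p0
        · left; exact (hamb t (by omega)).2 hn
        · right; exact hex (D - t) t (by omega) (by omega)
  unfold outcome
  rw [hhit, ← hPhi D le_rfl, Phi_goal g i j (τ D) hD]

end

/-- Shortest Path: the Mover has no incentive to use a non-shortest path
against `π^{E*}`. -/
theorem no_nonshortest_path
    (g : Fin 2 → ℤ × ℤ) (hg : g 0 ≠ g 1) (p0 : ℤ × ℤ) (b0 : Fin 2 → ℝ)
    (hb0 : ∀ j, 0 ≤ b0 j) (i : Fin 2)
    (piM : MoverStrategy) (hM : ValidMover piM)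
    (hadm : Reaches piM (piEstar g) p0 b0 (g i))
    (hlong : mdist p0 (g i) < (hitTime piM (piEstar g) p0 b0 (g i) : ℤ))
    (piMstar : MoverStrategy) (hstar : IsMoverStar g i p0 b0 piMstar) :
    outcome g i piMstar (piEstar g) p0 b0 ≤ outcome g i piM (piEstar g) p0 b0 := by
  obtain ⟨j, hij⟩ : ∃ j : Fin 2, i ≠ j := by
    revert i; intro i _ _ _; fin_cases i
    · exact ⟨1, by decide⟩
    · exact ⟨0, by decide⟩
  rw [star_outcome g i j hij p0 b0 piMstar hstar]
  have hgoal : (traj piM (piEstar g) p0 b0 (hitTime piM (piEstar g) p0 b0 (g i))).1 = g i :=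
    Nat.sInf_mem (s := {t | (traj piM (piEstar g) p0 b0 t).1 = g i}) hadm
  have h := Phi_mono g i j hij p0 b0 piM hM (hitTime piM (piEstar g) p0 b0 (g i))
  rwa [Phi_goal g i j _ hgoal] at h
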